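/- In every execution of the Figure 3 algorithm, whenever the producer performs its write of an element x to Items[m] (the final write step of a successful Insert), the value of TS[m] at that step is 0. -/

import Mathlib

/-!
A formal model of the algorithm of Figure 3 (a wait-free, linearizable
1-bounded bag with one producer and `n` consumers).

Locations `1 .. n+1` are modelled as `Fin (n+1)` with index `0` playing the
role of location `1` (so `TS[1] = 1` initially becomes `ts 0 = true`).
Registers holding elements or `⊥` are modelled as `Option ℕ` (with `none` = ⊥),
test&set objects as `Bool` (`true` = 1).

An execution is a list of actions (`Act`), each of which performs exactly one
shared-memory access (an invocation of an operation is merged with the first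
shared access of that operation, and nondeterministic choices and results of
accesses are recorded in the action).  `step` is the (partial, deterministic)
transition function; a list `tr` is a (finite) execution iff
`run n tr (init n) = some C` for some configuration `C`.
-/

namespace Fig3

abbrev Loc (n : ℕ) := Fin (n + 1)

/-- Local state (program counter and local variables) of the single producer,
apart from the persistent local variables `used` and `m` that are kept in the
configuration. -/
inductive PSt (n : ℕ) where
  | idle : PSt n
  | clear (x : ℕ) : PSt n
  | collect (x : ℕ) (i : ℕ) (hz : Finset (Loc n)) : PSt n
  | allocSt (x : ℕ) (hz : Finset (Loc n)) : PSt n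
  | resets (x : ℕ) (hz : Finset (Loc n)) (todo : Finset (Loc n)) : PSt n
  deriving DecidableEq

/-- Local state of a consumer. -/
inductive CSt (n : ℕ) where
  | idle : CSt n
  | haz (a : Loc n) : CSt n
  | read (a : Loc n) : CSt n
  | tas (a : Loc n) (x : ℕ) : CSt n
  | clear (res : Option ℕ) : CSt n
  deriving DecidableEq

structure Cfg (n : ℕ) where
  items : Loc n → Option ℕ
  ts : Loc n → Bool
  alloc : Loc n
  haz : Fin n → Option (Loc n)
  pst : PSt n
  used : Finset (Loc n)
  m : Loc n
  cst : Fin n → CSt n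

inductive Act (n : ℕ) where
  /-- the producer begins `Insert(x)` by reading `TS[m]`, obtaining `v`;
      if `v = false` (i.e. 0) the operation immediately returns FULL -/
  | insCheck (x : ℕ) (v : Bool) : Act n
  /-- the producer writes ⊥ to `Items[m]` and adds `m` to `used` -/
  | insClear : Act n
  /-- the producer reads the next entry of `Hazards` -/
  | insCollect : Act n
  /-- the producer chooses a fresh non-hazardous location `m'`
      and writes it to `Allocated` -/
  | insAlloc (m' : Loc n) : Act n
  /-- the producer resets `TS[k]` -/
  | insReset (k : Loc n) : Act n
  /-- the producer writes its element to `Items[m]` and returns OK -/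
  | insWrite : Act n
  /-- consumer `i` begins `Take()` by reading `Allocated`, obtaining `a` -/
  | takeBegin (i : Fin n) (a : Loc n) : Act n
  /-- consumer `i` writes its announced location to `Hazards[i]` -/
  | takeHaz (i : Fin n) : Act n
  /-- consumer `i` reads `Items[a]`, obtaining `x` -/
  | takeRead (i : Fin n) (x : Option ℕ) : Act n
  /-- consumer `i` performs `t&s()` on `TS[a]`; `won = true` iff it was successful -/
  | takeTas (i : Fin n) (won : Bool) : Act n
  /-- consumer `i` writes ⊥ to `Hazards[i]` and returns `res`
      (`none` meaning EMPTY) -/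
  | takeEnd (i : Fin n) (res : Option ℕ) : Act n
  deriving DecidableEq

/-- One step of the algorithm: `step n C e = some C'` iff action `e` is enabled
in configuration `C` (including that all recorded read/`t&s` results match the
shared state) and leads to configuration `C'`. -/
def step (n : ℕ) (C : Cfg n) : Act n → Option (Cfg n)
  | .insCheck x v =>
      match C.pst with
      | .idle =>
          if v = C.ts C.m then
            some (if v then { C with pst := .clear x } else C)
          else none
      | _ => none
  | .insClear =>
      match C.pst with
      | .clear x =>
          some { C with
                   items := Function.update C.items C.m none
                   used := insert C.m C.used
                   pst := if n = 0 then .allocSt x ∅ else .collect x 0 ∅ }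
      | _ => none
  | .insCollect =>
      match C.pst with
      | .collect x i hz =>
          if h : i < n then
            let hz' := match C.haz ⟨i, h⟩ with
                       | some a => insert a hz
                       | none => hz
            some { C with pst := if i + 1 = n then .allocSt x hz' else .collect x (i + 1) hz' }
          else none
      | _ => none
  | .insAlloc m' =>
      match C.pst with
      | .allocSt x hz =>
          if m' ∈ hz then none
          else some { C with
                        alloc := m'
                        m := m'
                        pst := .resets x hz (C.used \ hz) }
      | _ => none
  | .insReset k =>
      match C.pst with
      | .resets x hz todo =>
          if k ∈ todo then
            some { C with
                     ts := Function.update C.ts k false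
                     pst := .resets x hz (todo.erase k) }
          else none
      | _ => none
  | .insWrite =>
      match C.pst with
      | .resets x hz todo =>
          if todo = ∅ then
            some { C with
                     items := Function.update C.items C.m (some x)
                     used := C.used ∩ hz
                     pst := .idle }
          else none
      | _ => none
  | .takeBegin i a =>
      match C.cst i with
      | .idle =>
          if a = C.alloc then some { C with cst := Function.update C.cst i (.haz a) }
          else none
      | _ => none
  | .takeHaz i =>
      match C.cst i with
      | .haz a =>
          some { C with
                   haz := Function.update C.haz i (some a)
                   cst := Function.update C.cst i (.read a) }
      | _ => none
  | .takeRead i xo =>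
      match C.cst i with
      | .read a =>
          if xo = C.items a then
            some { C with
                     cst := Function.update C.cst i
                       (match xo with
                        | some v => .tas a v
                        | none => .clear none) }
          else none
      | _ => none
  | .takeTas i won =>
      match C.cst i with
      | .tas a x =>
          if won = !(C.ts a) then
            some { C with
                     ts := Function.update C.ts a true
                     cst := Function.update C.cst i (.clear (if won then some x else none)) }
          else none
      | _ => none
  | .takeEnd i res =>
      match C.cst i with
      | .clear r =>
          if res = r then
            some { C with
                     haz := Function.update C.haz i none
                     cst := Function.update C.cst i .idle }
          else none
      | _ => none

/-- The initial configuration: all items ⊥, `TS[1] = 1` and all other test&set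
objects 0, `Allocated = m = 1`, `used = ∅`, everyone idle. -/
def init (n : ℕ) : Cfg n where
  items := fun _ => none
  ts := fun k => decide (k = 0)
  alloc := 0
  haz := fun _ => none
  pst := .idle
  used := ∅
  m := 0
  cst := fun _ => .idle

/-- Run a list of actions from a configuration. -/
def run (n : ℕ) : List (Act n) → Cfg n → Option (Cfg n)
  | [], C => some C
  | e :: tr, C => (step n C e).bind (run n tr)

/-- The configuration reached after the first `t` actions of `tr`. -/
def cfgAt (n : ℕ) (tr : List (Act n)) (t : ℕ) : Option (Cfg n) :=
  run n (tr.take t) (init n)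

end Fig3

namespace Fig3

/-- The producer is in a phase in which `Items[m]` may be non-empty. -/
def PSt.early {n : ℕ} : PSt n → Prop
  | .idle => True
  | .clear _ => True
  | _ => False

/-- Index `i` has already been collected and `a` is therefore protected. -/
def PSt.prot {n : ℕ} : PSt n → Fin n → Loc n → Prop
  | .idle, _, _ => True
  | .clear _, _, _ => True
  | .collect _ j hz, i, a => i.val < j → a ∈ hz
  | .allocSt _ hz, _, a => a ∈ hz
  | .resets _ hz _, _, a => a ∈ hz

/-- During the resets, set test&set objects are hazardous or still to be reset. -/
def PSt.rok {n : ℕ} : PSt n → Loc n → Prop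
  | .resets _ hz todo, k => k ∈ hz ∨ k ∈ todo
  | _, _ => True

/-- The location chosen is not hazardous. -/
def PSt.mok {n : ℕ} : PSt n → Loc n → Prop
  | .resets _ hz _, m => m ∉ hz
  | _, _ => True

theorem PSt.prot_of_early {n : ℕ} {p : PSt n} (h : p.early) (i : Fin n) (a : Loc n) :
    p.prot i a := by
  cases p <;> simp_all [PSt.early, PSt.prot]

theorem PSt.rok_of_prot {n : ℕ} {p : PSt n} {i : Fin n} {a : Loc n} (h : p.prot i a) :
    p.rok a := by
  cases p <;> simp_all [PSt.rok, PSt.prot]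

structure Inv {n : ℕ} (C : Cfg n) : Prop where
  items : ∀ k x, C.items k = some x → k = C.m ∧ C.pst.early
  hread : ∀ i a, C.cst i = .read a → C.haz i = some a
  htas : ∀ i a x, C.cst i = .tas a x → C.haz i = some a
  tused : ∀ i a x, C.cst i = .tas a x → (a = C.m ∧ C.pst.early) ∨ a ∈ C.used
  tprot : ∀ i a x, C.cst i = .tas a x → C.pst.prot i a
  ts : ∀ k, C.ts k = true → (k = C.m ∧ C.pst.early) ∨ k ∈ C.used
  rok : ∀ k, C.ts k = true → C.pst.rok k
  mok : C.pst.mok C.m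

theorem inv_init (n : ℕ) : Inv (init n) := by
  constructor <;> simp [init, PSt.early, PSt.prot, PSt.rok, PSt.mok]

set_option maxHeartbeats 4000000 in
theorem inv_step {n : ℕ} {C C' : Cfg n} (e : Act n) (h : Inv C)
    (hs : step n C e = some C') : Inv C' := by
  obtain ⟨h1, h2, h3, h4, h5, h6, h7, h8⟩ := h
  obtain ⟨items, ts, alloc, haz, pst, used, m, cst⟩ := C
  have he : pst.early → ∀ i a, pst.prot i a := PSt.prot_of_early
  have hr : ∀ i a x, cst i = .tas a x → pst.rok a :=
    fun i a x hx => PSt.rok_of_prot (h5 i a x hx)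
  have hlt : ∀ i a x, cst i = .tas a x → i.val < n := fun i _ _ _ => i.isLt
  cases e <;> simp only [step] at hs <;> simp only at h1 h2 h3 h4 h5 h6 h7 h8 <;>
    split at hs <;> try contradiction
  all_goals rename_i hp
  all_goals first | subst hp | skip
  all_goals (repeat' split at hs) <;> try contradiction
  all_goals (injection hs with hs; subst hs)
  all_goals constructor <;> grind [PSt.early, PSt.prot, PSt.rok, PSt.mok, Function.update_apply]

theorem inv_run {n : ℕ} (tr : List (Act n)) : ∀ {C C' : Cfg n}, Inv C →
    run n tr C = some C' → Inv C' := by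
  induction tr with
  | nil => intro C C' h hr; simp only [run, Option.some.injEq] at hr; exact hr ▸ h
  | cons e tr ih =>
    intro C C' h hr
    simp only [run, Option.bind_eq_some_iff] at hr
    obtain ⟨D, hD, hr⟩ := hr
    exact ih (inv_step e h hD) hr

end Fig3

/--
In every execution of the Figure 3 algorithm, whenever the
producer performs its write of an element `x` to `Items[m]` (the final write
step `Act.insWrite` of a successful `Insert`), the value of `TS[m]` at that
step is 0 (i.e. `false`).
-/
theorem fig3_ts_zero_at_item_write (n : ℕ) (tr : List (Fig3.Act n))
    (C C' : Fig3.Cfg n)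
    (hrun : Fig3.run n tr (Fig3.init n) = some C)
    (hstep : Fig3.step n C Fig3.Act.insWrite = some C') :
    C.ts C.m = false := by
  have h := Fig3.inv_run tr (Fig3.inv_init n) hrun
  have h7 := h.rok C.m
  have h8 := h.mok
  simp only [Fig3.step] at hstep
  split at hstep
  · rename_i x hz todo hp
    grind [Fig3.PSt.rok, Fig3.PSt.mok]
  · contradiction
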